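/- Let ω be a radial continuous weight on the unit disc. (i) If ω is regular, then there exists γ₀ = γ₀(ω) such that for all γ > γ₀, ∫_𝔻 ω(z)/|1−\bar{a}z|^{γ+1} dA(z) ≍ (∫_{|a|}^1 ω(r) dr)/(1−|a|)^γ ≍ ω(a)/(1−|a|)^{γ−1} for all a ∈ 𝔻, with constants independent of a. (ii) If ω is rapidly increasing, then for all γ > 0, ∫_𝔻 ω(z)/|1−\bar{a}z|^{γ+1} dA(z) ≍ (∫_{|a|}^1 ω(r) dr)/(1−|a|)^γ for all a ∈ 𝔻. -/

import Mathlib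

open MeasureTheory Set Filter

noncomputable section

/-- `wInt ω r = ∫_r^1 ω(s) ds`. -/
def wInt (ω : ℝ → ℝ) (r : ℝ) : ℝ := ∫ s in r..1, ω s

/-- A radial weight on the unit disc, identified with a function on `[0,1)`:
positive and integrable. -/
def IsRadialWeight (ω : ℝ → ℝ) : Prop :=
  (∀ r ∈ Set.Ico (0:ℝ) 1, 0 < ω r) ∧ IntegrableOn ω (Set.Ico (0:ℝ) 1)

/-- A radial continuous weight. -/
def IsRadialContinuousWeight (ω : ℝ → ℝ) : Prop :=
  IsRadialWeight ω ∧ ContinuousOn ω (Set.Ico (0:ℝ) 1)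

/-- A regular weight: radial continuous with `ψ_ω(r) ≍ 1 - r`, i.e.
`(1-r)·ω(r) ≍ ∫_r^1 ω(s) ds` on `[0,1)`. -/
def IsRegularWeight (ω : ℝ → ℝ) : Prop :=
  IsRadialContinuousWeight ω ∧ ∃ c C : ℝ, 0 < c ∧ 0 < C ∧
    ∀ r ∈ Set.Ico (0:ℝ) 1,
      c * ((1 - r) * ω r) ≤ wInt ω r ∧ wInt ω r ≤ C * ((1 - r) * ω r)

/-- A rapidly increasing weight: radial continuous with
`ψ_ω(r)/(1-r) = (∫_r^1 ω)/(ω(r)(1-r)) → ∞` as `r → 1⁻`. -/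
def IsRapidlyIncreasing (ω : ℝ → ℝ) : Prop :=
  IsRadialContinuousWeight ω ∧
    Tendsto (fun r => wInt ω r / (ω r * (1 - r))) (nhdsWithin 1 (Set.Iio 1)) atTop

/-- The open unit disc in `ℂ`. -/
def unitDisc : Set ℂ := {z : ℂ | ‖z‖ < 1}


/-- `∫_{-π}^{π} |1 - x e^{iθ}|^{-s} dθ` as an extended nonnegative real. -/
def angularIntegral (s x : ℝ) : ENNReal :=
  ∫⁻ θ in Ioo (-Real.pi) Real.pi, ENNReal.ofReal (‖1 - (x : ℂ) * Complex.exp (Complex.I * θ)‖ ^ (-s))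

lemma one_sub_le_norm_one_sub_mul_exp {x : ℝ} (hx : 0 ≤ x) (θ : ℝ) :
    1 - x ≤ ‖1 - (x : ℂ) * Complex.exp (Complex.I * θ)‖ := by
  have h := norm_sub_norm_le (1 : ℂ) ((x : ℂ) * Complex.exp (Complex.I * θ))
  rw [norm_mul, Complex.norm_exp_I_mul_ofReal, Complex.norm_real, Real.norm_of_nonneg hx] at h
  simpa using h

lemma norm_one_sub_mul_exp_le {x : ℝ} (hx : 0 ≤ x) (hx1 : x < 1) (θ : ℝ) :
    ‖1 - (x : ℂ) * Complex.exp (Complex.I * θ)‖ ≤ (1 - x) + |θ| := by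
  have h : 1 - (x : ℂ) * Complex.exp (Complex.I * θ)
      = ((1 - x : ℝ) : ℂ) - (x : ℂ) * (Complex.exp (Complex.I * θ) - 1) := by
    push_cast; ring
  rw [h]
  refine (norm_sub_le _ _).trans ?_
  rw [norm_mul, Complex.norm_real, Complex.norm_real, Real.norm_of_nonneg hx,
    Real.norm_of_nonneg (by linarith)]
  have h2 : ‖Complex.exp (Complex.I * θ) - 1‖ ≤ |θ| := Real.norm_exp_I_mul_ofReal_sub_one_le
  nlinarith [abs_nonneg θ]

lemma add_abs_le_norm_one_sub_mul_exp {x θ : ℝ} (hx : 0 ≤ x) (hx1 : x < 1)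
    (hθ : |θ| ≤ Real.pi) :
    (1 - x) + |θ| ≤ (1 + Real.pi) * ‖1 - (x : ℂ) * Complex.exp (Complex.I * θ)‖ := by
  have h1 := one_sub_le_norm_one_sub_mul_exp hx θ
  have h2 : ‖Complex.exp (Complex.I * θ) - 1‖
      ≤ ‖1 - (x : ℂ) * Complex.exp (Complex.I * θ)‖ + (1 - x) := by
    have h : Complex.exp (Complex.I * θ) - 1
        = -(1 - (x : ℂ) * Complex.exp (Complex.I * θ))
          + ((1 - x : ℝ) : ℂ) * Complex.exp (Complex.I * θ) := by
      push_cast; ring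
    rw [h]
    refine (norm_add_le _ _).trans ?_
    rw [norm_neg, norm_mul, Complex.norm_exp_I_mul_ofReal, Complex.norm_real,
      Real.norm_of_nonneg (by linarith), mul_one]
  have h3 : 2 * |θ| ≤ Real.pi * ‖Complex.exp (Complex.I * θ) - 1‖ := by
    rw [Complex.norm_exp_I_mul_ofReal_sub_one, norm_mul, Real.norm_eq_abs, Real.norm_eq_abs]
    have h4 := Real.mul_le_sin (x := |θ| / 2) (by positivity) (by linarith)
    have h5 : Real.sin (|θ| / 2) ≤ |Real.sin (θ / 2)| := by
      rcases abs_cases θ with ⟨h, _⟩ | ⟨h, _⟩ <;> rw [h]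
      · exact le_abs_self _
      · rw [neg_div, Real.sin_neg]; exact neg_le_abs _
    have h6 : |θ| = Real.pi * (2 / Real.pi * (|θ| / 2)) := by
      field_simp
    have h7 := mul_le_mul_of_nonneg_left (h4.trans h5) Real.pi_pos.le
    rw [abs_of_pos (two_pos : (0:ℝ) < 2)]
    linarith
  have h4 := mul_le_mul_of_nonneg_left (h2.trans (add_le_add_right h1 _)) Real.pi_pos.le
  nlinarith

lemma exists_angularIntegral_le {s : ℝ} (hs : 1 < s) : ∃ C : ℝ, 0 < C ∧
    ∀ x : ℝ, 0 ≤ x → x < 1 → angularIntegral s x ≤ ENNReal.ofReal (C * (1 - x) ^ (1 - s)) := by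
  have hint : Integrable (fun x : ℝ => (1 + ‖x‖) ^ (-s)) :=
    integrable_one_add_norm (by simpa using hs)
  set K := ∫ x : ℝ, (1 + ‖x‖) ^ (-s) with hK
  have hK0 : 0 ≤ K := integral_nonneg fun x => by positivity
  have hpi := Real.pi_pos
  refine ⟨(1 + Real.pi) ^ s * (K + 1), by positivity, fun x hx hx1 => ?_⟩
  have hδ : 0 < 1 - x := by linarith
  have hint' : Integrable (fun θ : ℝ =>
      (1 + Real.pi) ^ s * ((1 - x) ^ (-s) * (1 + ‖θ / (1 - x)‖) ^ (-s))) :=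
    ((hint.comp_div hδ.ne').const_mul _).const_mul _
  calc angularIntegral s x
      ≤ ∫⁻ θ in Ioo (-Real.pi) Real.pi, ENNReal.ofReal
          ((1 + Real.pi) ^ s * ((1 - x) ^ (-s) * (1 + ‖θ / (1 - x)‖) ^ (-s))) := by
        refine setLIntegral_mono' measurableSet_Ioo fun θ hθ => ENNReal.ofReal_le_ofReal ?_
        have hle := add_abs_le_norm_one_sub_mul_exp hx hx1 (abs_le.2 ⟨hθ.1.le, hθ.2.le⟩)
        have hpos := hδ.trans_le (one_sub_le_norm_one_sub_mul_exp hx θ)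
        have h1 : (1 - x) * (1 + ‖θ / (1 - x)‖) = (1 - x) + |θ| := by
          rw [norm_div, Real.norm_of_nonneg hδ.le, Real.norm_eq_abs]; field_simp
        rw [← Real.mul_rpow hδ.le (by positivity), h1]
        have h2 := Real.rpow_le_rpow_of_nonpos (z := -s) (by positivity) hle (by linarith)
        rw [Real.mul_rpow (by positivity) (norm_nonneg _)] at h2
        calc _ = (1 + Real.pi) ^ s * ((1 + Real.pi) ^ (-s) *
                ‖1 - (x : ℂ) * Complex.exp (Complex.I * θ)‖ ^ (-s)) := by
              rw [← mul_assoc, ← Real.rpow_add (by positivity)]; simp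
          _ ≤ _ := mul_le_mul_of_nonneg_left h2 (by positivity)
    _ ≤ ∫⁻ θ, ENNReal.ofReal
          ((1 + Real.pi) ^ s * ((1 - x) ^ (-s) * (1 + ‖θ / (1 - x)‖) ^ (-s))) :=
        setLIntegral_le_lintegral _ _
    _ = ENNReal.ofReal ((1 + Real.pi) ^ s * ((1 - x) ^ (-s) * ((1 - x) * K))) := by
        rw [← ofReal_integral_eq_lintegral_ofReal hint' (Eventually.of_forall fun θ => by positivity)]
        rw [integral_const_mul, integral_const_mul,
          Measure.integral_comp_div (fun y : ℝ => (1 + ‖y‖) ^ (-s)), abs_of_pos hδ, smul_eq_mul]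
    _ ≤ _ := by
        refine ENNReal.ofReal_le_ofReal ?_
        have h : (1 - x) ^ (1 - s) = (1 - x) ^ (-s) * (1 - x) := by
          rw [sub_eq_neg_add 1 s, Real.rpow_add_one hδ.ne']
        rw [h]
        have : 0 ≤ (1 + Real.pi) ^ s * ((1 - x) ^ (-s) * (1 - x)) := by positivity
        nlinarith

lemma le_angularIntegral {s x : ℝ} (hs : 0 ≤ s) (hx : 0 ≤ x) (hx1 : x < 1) :
    ENNReal.ofReal (2 ^ (-s) * (1 - x) ^ (1 - s)) ≤ angularIntegral s x := by
  have hδ : 0 < 1 - x := by linarith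
  have hpi := Real.pi_gt_three
  calc ENNReal.ofReal (2 ^ (-s) * (1 - x) ^ (1 - s))
      = ∫⁻ _θ in Ioo 0 (1 - x), ENNReal.ofReal ((2 * (1 - x)) ^ (-s)) := by
        rw [setLIntegral_const, Real.volume_Ioo, ← ENNReal.ofReal_mul (by positivity), sub_zero,
          Real.mul_rpow two_pos.le hδ.le, mul_assoc, ← Real.rpow_add_one hδ.ne', sub_eq_neg_add 1 s]
    _ ≤ ∫⁻ θ in Ioo 0 (1 - x),
          ENNReal.ofReal (‖1 - (x : ℂ) * Complex.exp (Complex.I * θ)‖ ^ (-s)) := by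
        refine setLIntegral_mono' measurableSet_Ioo fun θ hθ => ENNReal.ofReal_le_ofReal ?_
        refine Real.rpow_le_rpow_of_nonpos
          (hδ.trans_le (one_sub_le_norm_one_sub_mul_exp hx θ)) ?_ (by linarith)
        have := norm_one_sub_mul_exp_le hx hx1 θ
        rw [abs_of_pos hθ.1] at this
        linarith [hθ.2]
    _ ≤ _ := lintegral_mono_set (Ioo_subset_Ioo (by linarith) (by linarith))

lemma lintegral_radial_mul_kernel {w : ℝ → ℝ} (hw : Measurable w) (s t : ℝ) :
    ∫⁻ z : ℂ, ENNReal.ofReal (w ‖z‖) * ENNReal.ofReal (‖1 - (t : ℂ) * z‖ ^ (-s)) =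
      ∫⁻ r in Ioi (0 : ℝ), ENNReal.ofReal (r * w r) * angularIntegral s (t * r) := by
  rw [← Complex.lintegral_comp_polarCoord_symm, polarCoord_target,
    Measure.volume_eq_prod, setLIntegral_prod]
  · refine setLIntegral_congr_fun measurableSet_Ioi fun r hr => ?_
    have hr : 0 < r := hr
    rw [angularIntegral, ← lintegral_const_mul _ (by fun_prop)]
    refine lintegral_congr fun θ => ?_
    rw [Complex.norm_polarCoord_symm, Complex.polarCoord_symm_apply, abs_of_pos hr, smul_eq_mul,
      ← mul_assoc, ← ENNReal.ofReal_mul hr.le, mul_comm Complex.I, Complex.exp_mul_I]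
    push_cast
    simp only [mul_assoc]
  · simp only [Complex.polarCoord_symm_apply]
    fun_prop

lemma lintegral_mul_kernel_eq_norm (w : ℝ → ENNReal) (s : ℝ) (a : ℂ) :
    ∫⁻ z : ℂ, w ‖z‖ * ENNReal.ofReal (‖1 - (starRingEnd ℂ) a * z‖ ^ (-s)) =
      ∫⁻ z : ℂ, w ‖z‖ * ENNReal.ofReal (‖1 - ((‖a‖ : ℝ) : ℂ) * z‖ ^ (-s)) := by
  set e := rotation (Circle.exp a.arg)
  have he : MeasurePreserving e := e.measurePreserving
  rw [← he.lintegral_comp_emb e.toMeasurableEquiv.measurableEmbedding]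
  refine lintegral_congr fun z => ?_
  have h : (starRingEnd ℂ) a * e z = ((‖a‖ : ℝ) : ℂ) * z := by
    conv_lhs => rw [← Complex.norm_mul_exp_arg_mul_I a]
    rw [rotation_apply, Circle.coe_exp, map_mul, Complex.conj_ofReal, ← Complex.exp_conj, map_mul,
      Complex.conj_ofReal, Complex.conj_I, mul_assoc, ← mul_assoc (Complex.exp _),
      ← Complex.exp_add]
    simp
  rw [e.norm_map, h]

lemma mem_unitDisc {z : ℂ} : z ∈ unitDisc ↔ ‖z‖ < 1 := by simp [unitDisc]

namespace IsRadialContinuousWeight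

variable {ω : ℝ → ℝ}

lemma intervalIntegrable (hω : IsRadialContinuousWeight ω) {s t : ℝ} (hs : 0 ≤ s) (hst : s ≤ t)
    (ht : t ≤ 1) : IntervalIntegrable ω volume s t := by
  rw [intervalIntegrable_iff_integrableOn_Ioo_of_le hst]
  exact hω.1.2.mono_set fun x hx => ⟨hs.trans hx.1.le, hx.2.trans_le ht⟩

lemma wInt_pos (hω : IsRadialContinuousWeight ω) {t : ℝ} (ht : t ∈ Ico (0 : ℝ) 1) :
    0 < wInt ω t :=
  intervalIntegral.intervalIntegral_pos_of_pos_on (hω.intervalIntegrable ht.1 ht.2.le le_rfl)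
    (fun x hx => hω.1.1 x ⟨ht.1.trans hx.1.le, hx.2⟩) ht.2

lemma wInt_eq_add (hω : IsRadialContinuousWeight ω) {s t : ℝ} (hs : 0 ≤ s) (hst : s ≤ t)
    (ht : t < 1) : wInt ω s = (∫ r in s..t, ω r) + wInt ω t :=
  (intervalIntegral.integral_add_adjacent_intervals (hω.intervalIntegrable hs hst ht.le)
    (hω.intervalIntegrable (hs.trans hst) ht.le le_rfl)).symm

lemma integral_nonneg (hω : IsRadialContinuousWeight ω) {s t : ℝ} (hs : 0 ≤ s) (hst : s ≤ t)
    (ht : t < 1) : 0 ≤ ∫ r in s..t, ω r :=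
  intervalIntegral.integral_nonneg hst fun x hx =>
    (hω.1.1 x ⟨hs.trans hx.1, hx.2.trans_lt ht⟩).le

lemma wInt_le_wInt (hω : IsRadialContinuousWeight ω) {s t : ℝ} (hs : 0 ≤ s) (hst : s ≤ t)
    (ht : t < 1) : wInt ω t ≤ wInt ω s := by
  have := hω.wInt_eq_add hs hst ht
  have := hω.integral_nonneg hs hst ht
  linarith

lemma hasDerivAt_wInt (hω : IsRadialContinuousWeight ω) {t : ℝ} (ht : t ∈ Ioo (0 : ℝ) 1) :
    HasDerivAt (wInt ω) (-ω t) t := by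
  have hc : ContinuousOn ω (Ioo 0 1) := hω.2.mono Ioo_subset_Ico_self
  exact intervalIntegral.integral_hasDerivAt_left
    (hω.intervalIntegrable ht.1.le ht.2.le le_rfl)
    (hc.stronglyMeasurableAtFilter isOpen_Ioo t ht)
    (hc.continuousAt (isOpen_Ioo.mem_nhds ht))

lemma continuousOn_wInt (hω : IsRadialContinuousWeight ω) {s t : ℝ} (hs : 0 ≤ s) (ht : t < 1) :
    ContinuousOn (wInt ω) (Icc s t) := by
  rcases lt_or_ge t s with h | hst
  · simp [Icc_eq_empty_of_lt h]
  have h : ContinuousOn (fun u => ∫ r in (1 : ℝ)..u, ω r) (uIcc 1 0) :=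
    intervalIntegral.continuousOn_primitive_interval'
      (hω.intervalIntegrable le_rfl zero_le_one le_rfl).symm left_mem_uIcc
  have h' : wInt ω = fun u => -∫ r in (1 : ℝ)..u, ω r := by
    ext u; rw [wInt, intervalIntegral.integral_symm]
  rw [h']
  refine (h.mono ?_).neg
  rw [uIcc_of_ge zero_le_one]
  exact Icc_subset_Icc hs ht.le

lemma continuousOn_mul_rpow (hω : IsRadialContinuousWeight ω) (γ : ℝ) :
    ContinuousOn (fun r => ω r * (1 - r) ^ (-γ)) (Ico 0 1) :=
  hω.2.mul (ContinuousOn.rpow_const (by fun_prop) fun x hx => Or.inl (by linarith [hx.2]))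

lemma intervalIntegrable_mul_rpow (hω : IsRadialContinuousWeight ω) (γ : ℝ) {s t : ℝ}
    (hs : 0 ≤ s) (hst : s ≤ t) (ht : t < 1) :
    IntervalIntegrable (fun r => ω r * (1 - r) ^ (-γ)) volume s t := by
  refine ContinuousOn.intervalIntegrable ((hω.continuousOn_mul_rpow γ).mono ?_)
  rw [uIcc_of_le hst]
  exact fun x hx => ⟨hs.trans hx.1, hx.2.trans_lt ht⟩

/-- A differential inequality controls the growth of `ŵ(t) (1 - t)^{-γ}` from below. -/
lemma integral_mul_rpow_le_sub (hω : IsRadialContinuousWeight ω) {β γ r₀ t : ℝ} (hβ : 0 < β)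
    (hβγ : β < γ) (hr₀ : 0 ≤ r₀) (h : ∀ r ∈ Ico r₀ 1, (1 - r) * ω r ≤ β * wInt ω r)
    (hrt : r₀ ≤ t) (ht : t < 1) :
    (γ / β - 1) * (∫ r in r₀..t, ω r * (1 - r) ^ (-γ)) ≤
      wInt ω t * (1 - t) ^ (-γ) - wInt ω r₀ * (1 - r₀) ^ (-γ) := by
  rw [← intervalIntegral.integral_const_mul]
  refine intervalIntegral.integral_le_sub_of_hasDeriv_right_of_le
    (g := fun x => wInt ω x * (1 - x) ^ (-γ))
    (g' := fun x => -ω x * (1 - x) ^ (-γ) + wInt ω x * (γ * (1 - x) ^ (-γ - 1))) hrt ?_ ?_ ?_ ?_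
  · exact (hω.continuousOn_wInt hr₀ ht).mul
      (ContinuousOn.rpow_const (by fun_prop) fun x hx => Or.inl (by linarith [hx.2]))
  · intro x hx
    have hx1 : 0 < 1 - x := by linarith [hx.2]
    have h1 : HasDerivAt (fun x : ℝ => (1 - x) ^ (-γ)) (γ * (1 - x) ^ (-γ - 1)) x := by
      have := ((hasDerivAt_id x).const_sub 1).rpow_const (p := -γ) (Or.inl hx1.ne')
      simpa using this
    exact ((hω.hasDerivAt_wInt ⟨hr₀.trans_lt hx.1, hx.2.trans ht⟩).mul h1).hasDerivWithinAt
  · rw [integrableOn_Icc_iff_integrableOn_Ioc, ← intervalIntegrable_iff_integrableOn_Ioc_of_le hrt]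
    exact (hω.intervalIntegrable_mul_rpow γ hr₀ hrt ht).const_mul _
  · intro x hx
    have hx1 : 0 < 1 - x := by linarith [hx.2]
    have h1 := h x ⟨hx.1.le, hx.2.trans ht⟩
    have h2 : (1 - x) ^ (-γ) = (1 - x) ^ (-γ - 1) * (1 - x) := by
      rw [← Real.rpow_add_one hx1.ne']; simp
    have h3 : γ / β * ((1 - x) * ω x) ≤ γ * wInt ω x := by
      rw [div_mul_eq_mul_div, div_le_iff₀ hβ]
      nlinarith [mul_le_mul_of_nonneg_left h1 (hβ.trans hβγ).le]
    have h4 := mul_le_mul_of_nonneg_left h3 (Real.rpow_nonneg hx1.le (-γ - 1))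
    rw [h2]
    linarith

lemma exists_integral_mul_rpow_le (hω : IsRadialContinuousWeight ω) {β γ r₀ : ℝ} (hβ : 0 < β)
    (hβγ : β < γ) (hr₀ : r₀ ∈ Ico (0 : ℝ) 1)
    (h : ∀ r ∈ Ico r₀ 1, (1 - r) * ω r ≤ β * wInt ω r) :
    ∃ K : ℝ, 0 < K ∧ ∀ t ∈ Ico (0 : ℝ) 1,
      (∫ r in (0 : ℝ)..t, ω r * (1 - r) ^ (-γ)) ≤ K * (wInt ω t * (1 - t) ^ (-γ)) := by
  have hγ : 0 < γ := hβ.trans hβγ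
  have hκ : 0 < γ / β - 1 := by rw [sub_pos, one_lt_div hβ]; exact hβγ
  have hr1 : 0 < 1 - r₀ := by linarith [hr₀.2]
  have hw0 : 0 < wInt ω 0 := hω.wInt_pos (by simp)
  have hwr := hω.wInt_pos hr₀
  have hP : 0 < (1 - r₀) ^ (-γ) := by positivity
  have one_le : ∀ t ∈ Ico (0 : ℝ) 1, 1 ≤ (1 - t) ^ (-γ) := fun t ht =>
    Real.one_le_rpow_of_pos_of_le_one_of_nonpos (by linarith [ht.2]) (by linarith [ht.1])
      (by linarith)
  have near_zero : ∀ t ∈ Icc 0 r₀,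
      (∫ r in (0 : ℝ)..t, ω r * (1 - r) ^ (-γ)) ≤ (1 - r₀) ^ (-γ) * wInt ω 0 := by
    intro t ht
    have ht1 := ht.2.trans_lt hr₀.2
    calc (∫ r in (0 : ℝ)..t, ω r * (1 - r) ^ (-γ))
        ≤ ∫ r in (0 : ℝ)..t, (1 - r₀) ^ (-γ) * ω r := by
          refine intervalIntegral.integral_mono_on ht.1
            (hω.intervalIntegrable_mul_rpow γ le_rfl ht.1 ht1)
            ((hω.intervalIntegrable le_rfl ht.1 ht1.le).const_mul _) fun x hx => ?_
          rw [mul_comm]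
          exact mul_le_mul_of_nonneg_right
            (Real.rpow_le_rpow_of_nonpos hr1 (by linarith [hx.2, ht.2]) (by linarith))
            (hω.1.1 x ⟨hx.1, hx.2.trans_lt ht1⟩).le
      _ ≤ _ := by
          rw [intervalIntegral.integral_const_mul, hω.wInt_eq_add le_rfl ht.1 ht1]
          have := hω.wInt_pos ⟨ht.1, ht1⟩
          exact mul_le_mul_of_nonneg_left (by linarith) hP.le
  set A := (1 - r₀) ^ (-γ) * wInt ω 0
  have hA : 0 < A := by positivity
  have lower_le : ∀ t ∈ Ico (0 : ℝ) 1, wInt ω r₀ ≤ wInt ω t * (1 - t) ^ (-γ) := by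
    intro t ht
    rcases le_total t r₀ with htr | hrt
    · have h1 := hω.wInt_le_wInt ht.1 htr hr₀.2
      nlinarith [one_le t ht]
    · have h1 := hω.integral_mul_rpow_le_sub hβ hβγ hr₀.1 h hrt ht.2
      have h2 : 0 ≤ ∫ r in r₀..t, ω r * (1 - r) ^ (-γ) :=
        intervalIntegral.integral_nonneg hrt fun x hx =>
          mul_nonneg (hω.1.1 x ⟨hr₀.1.trans hx.1, hx.2.trans_lt ht.2⟩).le
            (Real.rpow_nonneg (by linarith [hx.2, ht.2]) _)
      have h3 := mul_nonneg hκ.le h2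
      nlinarith [one_le r₀ hr₀]
  refine ⟨A / wInt ω r₀ + (γ / β - 1)⁻¹, by positivity, fun t ht => ?_⟩
  set F := wInt ω t * (1 - t) ^ (-γ)
  have hF : 0 < F := hwr.trans_le (lower_le t ht)
  have hAF : A ≤ A / wInt ω r₀ * F := by
    rw [div_mul_eq_mul_div, le_div_iff₀ hwr]
    exact mul_le_mul_of_nonneg_left (lower_le t ht) hA.le
  rw [add_mul]
  rcases le_total t r₀ with htr | hrt
  · have := near_zero t ⟨ht.1, htr⟩
    have : 0 ≤ (γ / β - 1)⁻¹ * F := by positivity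
    linarith
  · rw [← intervalIntegral.integral_add_adjacent_intervals
      (hω.intervalIntegrable_mul_rpow γ le_rfl hr₀.1 hr₀.2)
      (hω.intervalIntegrable_mul_rpow γ hr₀.1 hrt ht.2)]
    refine add_le_add ((near_zero r₀ ⟨hr₀.1, le_rfl⟩).trans hAF) ?_
    rw [inv_mul_eq_div, le_div_iff₀ hκ, mul_comm]
    refine (hω.integral_mul_rpow_le_sub hβ hβγ hr₀.1 h hrt ht.2).trans ?_
    have : 0 < wInt ω r₀ * (1 - r₀) ^ (-γ) := by positivity
    linarith

lemma measurable_indicator (hω : IsRadialContinuousWeight ω) :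
    Measurable ((Ico (0 : ℝ) 1).indicator ω) := by
  classical
  rw [← piecewise_eq_indicator]
  exact hω.2.measurable_piecewise continuousOn_const measurableSet_Ico

lemma indicator_nonneg (hω : IsRadialContinuousWeight ω) (r : ℝ) :
    0 ≤ (Ico (0 : ℝ) 1).indicator ω r :=
  Set.indicator_nonneg (fun x hx => (hω.1.1 x hx).le) r

lemma lintegral_indicator_Ioi (hω : IsRadialContinuousWeight ω) {t : ℝ} (ht : t ∈ Ico (0 : ℝ) 1) :
    ∫⁻ r in Ioi t, ENNReal.ofReal ((Ico (0 : ℝ) 1).indicator ω r) =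
      ENNReal.ofReal (wInt ω t) := by
  have hint : Integrable ((Ico (0 : ℝ) 1).indicator ω) :=
    (integrable_indicator_iff measurableSet_Ico).2 hω.1.2
  rw [← ofReal_integral_eq_lintegral_ofReal hint.integrableOn
    (Eventually.of_forall hω.indicator_nonneg), setIntegral_indicator measurableSet_Ico, wInt,
    intervalIntegral.integral_of_le ht.2.le, integral_Ioc_eq_integral_Ioo]
  have h : Ioi t ∩ Ico (0 : ℝ) 1 = Ioo t 1 := by
    ext x
    simp only [mem_inter_iff, mem_Ioi, mem_Ico, mem_Ioo]
    exact ⟨fun h => ⟨h.1, h.2.2⟩, fun h => ⟨h.1, ht.1.trans h.1.le, h.2⟩⟩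
  rw [h]

/-- The kernel integral in radial form. -/
lemma setIntegral_kernel_eq_toReal (hω : IsRadialContinuousWeight ω) (γ : ℝ) (a : ℂ) :
    (∫ z in unitDisc, ω ‖z‖ / ‖1 - (starRingEnd ℂ) a * z‖ ^ (γ + 1)) =
      (∫⁻ r in Ioi (0 : ℝ), ENNReal.ofReal (r * (Ico (0 : ℝ) 1).indicator ω r) *
        angularIntegral (γ + 1) (‖a‖ * r)).toReal := by
  have hw := hω.measurable_indicator
  have hD : MeasurableSet unitDisc :=
    by
    unfold unitDisc; exact measurableSet_lt measurable_norm measurable_const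
  rw [← lintegral_radial_mul_kernel hw, ← lintegral_mul_kernel_eq_norm
    (fun r => ENNReal.ofReal ((Ico (0 : ℝ) 1).indicator ω r)), ← integral_indicator hD]
  have h : unitDisc.indicator (fun z => ω ‖z‖ / ‖1 - (starRingEnd ℂ) a * z‖ ^ (γ + 1)) =
      fun z => (Ico (0 : ℝ) 1).indicator ω ‖z‖ * ‖1 - (starRingEnd ℂ) a * z‖ ^ (-(γ + 1)) := by
    ext z
    by_cases hz : ‖z‖ < 1
    · rw [indicator_of_mem (mem_unitDisc.2 hz),
        indicator_of_mem (show ‖z‖ ∈ Ico (0 : ℝ) 1 from ⟨norm_nonneg _, hz⟩),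
        Real.rpow_neg (norm_nonneg _), div_eq_mul_inv]
    · rw [indicator_of_notMem (mt mem_unitDisc.1 hz),
        indicator_of_notMem (fun h : ‖z‖ ∈ Ico (0 : ℝ) 1 => hz h.2), zero_mul]
  rw [h, integral_eq_lintegral_of_nonneg_ae
    (Eventually.of_forall fun z => mul_nonneg (hω.indicator_nonneg _) (by positivity))
    (by fun_prop)]
  simp only [ENNReal.ofReal_mul (hω.indicator_nonneg _)]

lemma exists_le_lintegral_angularIntegral (hω : IsRadialContinuousWeight ω) {γ : ℝ} (hγ : 0 < γ) :
    ∃ c : ℝ, 0 < c ∧ ∀ t ∈ Ico (0 : ℝ) 1, ENNReal.ofReal (c * (wInt ω t / (1 - t) ^ γ)) ≤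
      ∫⁻ r in Ioi (0 : ℝ), ENNReal.ofReal (r * (Ico (0 : ℝ) 1).indicator ω r) *
        angularIntegral (γ + 1) (t * r) := by
  have hw0 : 0 < wInt ω 0 := hω.wInt_pos (by simp)
  have hw2 : 0 < wInt ω (1 / 2) := hω.wInt_pos (by norm_num)
  set w := (Ico (0 : ℝ) 1).indicator ω with hw
  refine ⟨1 / 2 * 2 ^ (-(γ + 1)) * 2 ^ (-γ) * (wInt ω (1 / 2) / wInt ω 0), by positivity,
    fun t ht => ?_⟩
  have ht1 : 0 < 1 - t := by linarith [ht.2]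
  set m := max t (1 / 2) with hm
  have hmem : m ∈ Ico (0 : ℝ) 1 := ⟨ht.1.trans (le_max_left _ _), max_lt ht.2 (by norm_num)⟩
  have hcomp : wInt ω (1 / 2) / wInt ω 0 * wInt ω t ≤ wInt ω m := by
    rw [div_mul_eq_mul_div, div_le_iff₀ hw0]
    rcases le_total t (1 / 2) with h | h
    · rw [hm, max_eq_right h]
      exact mul_le_mul_of_nonneg_left (hω.wInt_le_wInt le_rfl ht.1 ht.2) hw2.le
    · rw [hm, max_eq_left h, mul_comm]
      exact mul_le_mul_of_nonneg_left (hω.wInt_le_wInt le_rfl (by norm_num) (by norm_num))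
        (hω.wInt_pos ht).le
  set B := 1 / 2 * 2 ^ (-(γ + 1)) * (2 ^ (-γ) * (1 - t) ^ (-γ)) with hB
  have hB0 : 0 < B := by positivity
  calc _ ≤ ENNReal.ofReal (B * wInt ω m) := by
        refine ENNReal.ofReal_le_ofReal ?_
        rw [div_eq_mul_inv (wInt ω t), ← Real.rpow_neg ht1.le]
        calc _ = B * (wInt ω (1 / 2) / wInt ω 0 * wInt ω t) := by rw [hB]; ring
          _ ≤ _ := mul_le_mul_of_nonneg_left hcomp hB0.le
    _ = ∫⁻ r in Ioi m, ENNReal.ofReal B * ENNReal.ofReal (w r) := by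
        rw [lintegral_const_mul _ hω.measurable_indicator.ennreal_ofReal,
          hω.lintegral_indicator_Ioi hmem, ENNReal.ofReal_mul hB0.le]
    _ ≤ ∫⁻ r in Ioi m, ENNReal.ofReal (r * w r) * angularIntegral (γ + 1) (t * r) := by
        refine setLIntegral_mono' measurableSet_Ioi fun r hr => ?_
        have hr : m < r := hr
        have htr : t < r := (le_max_left _ _).trans_lt hr
        have h2r : 1 / 2 < r := (le_max_right _ _).trans_lt hr
        by_cases hr1 : r < 1
        swap
        · rw [hw, indicator_of_notMem (fun h => hr1 h.2)]; simp
        have hw0 := hω.indicator_nonneg r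
        have htr1 : 0 < 1 - t * r := by nlinarith [ht.1]
        refine le_trans ?_ (mul_le_mul_right (le_angularIntegral (s := γ + 1) (by linarith)
          (mul_nonneg ht.1 (by linarith)) (by linarith)) _)
        rw [← ENNReal.ofReal_mul hB0.le, ← ENNReal.ofReal_mul (mul_nonneg (by linarith) hw0)]
        refine ENNReal.ofReal_le_ofReal ?_
        have h1 : (2 : ℝ) ^ (-γ) * (1 - t) ^ (-γ) ≤ (1 - t * r) ^ (1 - (γ + 1)) := by
          rw [← Real.mul_rpow two_pos.le ht1.le, show 1 - (γ + 1) = -γ by ring]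
          exact Real.rpow_le_rpow_of_nonpos htr1 (by nlinarith [ht.1]) (by linarith)
        have h2 : 1 / 2 * w r ≤ r * w r := mul_le_mul_of_nonneg_right h2r.le hw0
        calc B * w r = (1 / 2 * w r) * (2 ^ (-(γ + 1)) * (2 ^ (-γ) * (1 - t) ^ (-γ))) := by
              rw [hB]; ring
          _ ≤ _ := mul_le_mul h2 (mul_le_mul_of_nonneg_left h1 (by positivity)) (by positivity)
              (mul_nonneg (by linarith) hw0)
    _ ≤ _ := lintegral_mono_set (Ioi_subset_Ioi hmem.1)

lemma exists_lintegral_angularIntegral_le (hω : IsRadialContinuousWeight ω) {β γ r₀ : ℝ}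
    (hβ : 0 < β) (hβγ : β < γ) (hr₀ : r₀ ∈ Ico (0 : ℝ) 1)
    (h : ∀ r ∈ Ico r₀ 1, (1 - r) * ω r ≤ β * wInt ω r) :
    ∃ C : ℝ, 0 < C ∧ ∀ t ∈ Ico (0 : ℝ) 1,
      ∫⁻ r in Ioi (0 : ℝ), ENNReal.ofReal (r * (Ico (0 : ℝ) 1).indicator ω r) *
        angularIntegral (γ + 1) (t * r) ≤ ENNReal.ofReal (C * (wInt ω t / (1 - t) ^ γ)) := by
  have hγ : 0 < γ := hβ.trans hβγ
  obtain ⟨K, hK, hKle⟩ := hω.exists_integral_mul_rpow_le hβ hβγ hr₀ h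
  obtain ⟨M, hM, hMle⟩ := exists_angularIntegral_le (s := γ + 1) (by linarith)
  rw [show 1 - (γ + 1) = -γ by ring] at hMle
  set w := (Ico (0 : ℝ) 1).indicator ω with hw
  refine ⟨M * (K + 1), by positivity, fun t ht => ?_⟩
  have ht1 : 0 < 1 - t := by linarith [ht.2]
  have pointwise : ∀ r ∈ Ico (0 : ℝ) 1, ∀ u : ℝ, 0 < u → u ≤ 1 - t * r →
      ENNReal.ofReal (r * w r) * angularIntegral (γ + 1) (t * r) ≤
        ENNReal.ofReal (M * (w r * u ^ (-γ))) := by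
    intro r hr u hu hur
    have hw0 := hω.indicator_nonneg r
    refine (mul_le_mul_right (hMle (t * r) (mul_nonneg ht.1 hr.1) (by linarith)) _).trans ?_
    rw [← ENNReal.ofReal_mul (mul_nonneg hr.1 hw0)]
    refine ENNReal.ofReal_le_ofReal ?_
    have h1 : (1 - t * r) ^ (-γ) ≤ u ^ (-γ) :=
      Real.rpow_le_rpow_of_nonpos hu hur (by linarith)
    have h2 : r * w r ≤ w r := mul_le_of_le_one_left hw0 hr.2.le
    calc _ ≤ w r * (M * u ^ (-γ)) :=
          mul_le_mul h2 (mul_le_mul_of_nonneg_left h1 hM.le)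
            (mul_nonneg hM.le (Real.rpow_nonneg (by linarith) _)) hw0
      _ = _ := by ring
  have inner : ∫⁻ r in Ioc 0 t, ENNReal.ofReal (r * w r) * angularIntegral (γ + 1) (t * r) ≤
      ENNReal.ofReal (M * (K * (wInt ω t * (1 - t) ^ (-γ)))) := by
    have hii := hω.intervalIntegrable_mul_rpow γ le_rfl ht.1 ht.2
    rw [intervalIntegrable_iff_integrableOn_Ioc_of_le ht.1] at hii
    calc _ ≤ ∫⁻ r in Ioc 0 t, ENNReal.ofReal (M * (ω r * (1 - r) ^ (-γ))) := by
          refine setLIntegral_mono' measurableSet_Ioc fun r hr => ?_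
          have hr' : r ∈ Ico (0 : ℝ) 1 := ⟨hr.1.le, hr.2.trans_lt ht.2⟩
          have := pointwise r hr' (1 - r) (by linarith [hr'.2]) (by nlinarith [hr.1, ht.2])
          rwa [show w r = ω r from indicator_of_mem hr' ω] at this ⊢
      _ = ENNReal.ofReal (M * ∫ r in (0 : ℝ)..t, ω r * (1 - r) ^ (-γ)) := by
          rw [intervalIntegral.integral_of_le ht.1, ← integral_const_mul,
            ofReal_integral_eq_lintegral_ofReal (hii.const_mul M)]
          refine (ae_restrict_iff' measurableSet_Ioc).2 (Eventually.of_forall fun r hr => ?_)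
          have hr1 : r < 1 := hr.2.trans_lt ht.2
          exact mul_nonneg hM.le (mul_nonneg (hω.1.1 r ⟨hr.1.le, hr1⟩).le
            (Real.rpow_nonneg (by linarith) _))
      _ ≤ _ := ENNReal.ofReal_le_ofReal (mul_le_mul_of_nonneg_left (hKle t ht) hM.le)
  have outer : ∫⁻ r in Ioi t, ENNReal.ofReal (r * w r) * angularIntegral (γ + 1) (t * r) ≤
      ENNReal.ofReal (M * (wInt ω t * (1 - t) ^ (-γ))) := by
    calc _ ≤ ∫⁻ r in Ioi t, ENNReal.ofReal (M * (1 - t) ^ (-γ)) * ENNReal.ofReal (w r) := by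
          refine setLIntegral_mono' measurableSet_Ioi fun r hr => ?_
          have hr : t < r := hr
          by_cases hr1 : r < 1
          · have := pointwise r ⟨ht.1.trans hr.le, hr1⟩ (1 - t) ht1 (by nlinarith [ht.1])
            rw [← ENNReal.ofReal_mul (by positivity)]
            exact this.trans_eq (by ring_nf)
          · rw [hw, indicator_of_notMem (fun h => hr1 h.2)]; simp
      _ = _ := by
          rw [lintegral_const_mul _ hω.measurable_indicator.ennreal_ofReal,
            hω.lintegral_indicator_Ioi ht, ← ENNReal.ofReal_mul (by positivity)]
          ring_nf
  have hwt := hω.wInt_pos ht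
  rw [← Ioc_union_Ioi_eq_Ioi ht.1]
  refine (lintegral_union_le _ _ _).trans ((add_le_add inner outer).trans_eq ?_)
  rw [← ENNReal.ofReal_add (by positivity) (by positivity), div_eq_mul_inv,
    ← Real.rpow_neg ht1.le]
  ring_nf

theorem exists_kernel_bounds (hω : IsRadialContinuousWeight ω) {β γ r₀ : ℝ}
    (hβ : 0 < β) (hβγ : β < γ) (hr₀ : r₀ ∈ Ico (0 : ℝ) 1)
    (h : ∀ r ∈ Ico r₀ 1, (1 - r) * ω r ≤ β * wInt ω r) :
    ∃ c C : ℝ, 0 < c ∧ 0 < C ∧ ∀ a ∈ unitDisc,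
      c * (wInt ω ‖a‖ / (1 - ‖a‖) ^ γ) ≤
          (∫ z in unitDisc, ω ‖z‖ / ‖1 - (starRingEnd ℂ) a * z‖ ^ (γ + 1)) ∧
        (∫ z in unitDisc, ω ‖z‖ / ‖1 - (starRingEnd ℂ) a * z‖ ^ (γ + 1)) ≤
          C * (wInt ω ‖a‖ / (1 - ‖a‖) ^ γ) := by
  obtain ⟨c, hc, hcle⟩ := hω.exists_le_lintegral_angularIntegral (hβ.trans hβγ)
  obtain ⟨C, hC, hCle⟩ := hω.exists_lintegral_angularIntegral_le hβ hβγ hr₀ h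
  refine ⟨c, C, hc, hC, fun a ha => ?_⟩
  have ht : ‖a‖ ∈ Ico (0 : ℝ) 1 := ⟨norm_nonneg a, mem_unitDisc.1 ha⟩
  have ht1 : 0 < 1 - ‖a‖ := by linarith [ht.2]
  have hwt := hω.wInt_pos ht
  rw [hω.setIntegral_kernel_eq_toReal]
  exact ⟨(ENNReal.ofReal_le_iff_le_toReal (ne_top_of_le_ne_top ENNReal.ofReal_ne_top
    (hCle _ ht))).1 (hcle _ ht), ENNReal.toReal_le_of_le_ofReal (by positivity) (hCle _ ht)⟩

end IsRadialContinuousWeight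

theorem stmt6 (ω : ℝ → ℝ) :
    (IsRegularWeight ω → ∃ γ₀ : ℝ, ∀ γ : ℝ, γ₀ < γ → ∃ c C : ℝ, 0 < c ∧ 0 < C ∧
      ∀ a ∈ unitDisc,
        (c * (wInt ω ‖a‖ / (1 - ‖a‖) ^ γ) ≤
            (∫ z in unitDisc, ω ‖z‖ / ‖1 - (starRingEnd ℂ) a * z‖ ^ (γ + 1)) ∧
          (∫ z in unitDisc, ω ‖z‖ / ‖1 - (starRingEnd ℂ) a * z‖ ^ (γ + 1)) ≤
            C * (wInt ω ‖a‖ / (1 - ‖a‖) ^ γ)) ∧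
        (c * (ω ‖a‖ / (1 - ‖a‖) ^ (γ - 1)) ≤ wInt ω ‖a‖ / (1 - ‖a‖) ^ γ ∧
          wInt ω ‖a‖ / (1 - ‖a‖) ^ γ ≤ C * (ω ‖a‖ / (1 - ‖a‖) ^ (γ - 1)))) ∧
    (IsRapidlyIncreasing ω → ∀ γ : ℝ, 0 < γ → ∃ c C : ℝ, 0 < c ∧ 0 < C ∧
      ∀ a ∈ unitDisc,
        c * (wInt ω ‖a‖ / (1 - ‖a‖) ^ γ) ≤
            (∫ z in unitDisc, ω ‖z‖ / ‖1 - (starRingEnd ℂ) a * z‖ ^ (γ + 1)) ∧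
          (∫ z in unitDisc, ω ‖z‖ / ‖1 - (starRingEnd ℂ) a * z‖ ^ (γ + 1)) ≤
            C * (wInt ω ‖a‖ / (1 - ‖a‖) ^ γ)) := by
  refine ⟨fun hω => ?_, fun hω γ hγ => ?_⟩
  · obtain ⟨hω, c₀, C₀, hc₀, hC₀, hreg⟩ := hω
    refine ⟨1 / c₀, fun γ hγ => ?_⟩
    obtain ⟨c, C, hc, hC, hb⟩ := hω.exists_kernel_bounds (β := 1 / c₀) (r₀ := 0) (by positivity) hγ
      (by simp) fun r hr => by
        rw [one_div, inv_mul_eq_div, le_div_iff₀ hc₀, mul_comm]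
        exact (hreg r hr).1
    refine ⟨min c c₀, max C C₀, lt_min hc hc₀, lt_max_of_lt_left hC, fun a ha => ?_⟩
    have ht : ‖a‖ ∈ Ico (0 : ℝ) 1 := ⟨norm_nonneg a, mem_unitDisc.1 ha⟩
    have ht1 : 0 < 1 - ‖a‖ := by linarith [ht.2]
    have hwt := hω.wInt_pos ht
    have hωt := hω.1.1 _ ht
    have hF : 0 ≤ wInt ω ‖a‖ / (1 - ‖a‖) ^ γ := by positivity
    have hG : ω ‖a‖ / (1 - ‖a‖) ^ (γ - 1) = (1 - ‖a‖) * ω ‖a‖ / (1 - ‖a‖) ^ γ := by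
      rw [Real.rpow_sub_one ht1.ne']
      field_simp
    have hG0 : 0 ≤ (1 - ‖a‖) * ω ‖a‖ / (1 - ‖a‖) ^ γ := by positivity
    rw [hG]
    refine ⟨⟨(mul_le_mul_of_nonneg_right (min_le_left _ _) hF).trans (hb a ha).1,
      (hb a ha).2.trans (mul_le_mul_of_nonneg_right (le_max_left _ _) hF)⟩,
      (mul_le_mul_of_nonneg_right (min_le_right _ _) hG0).trans ?_,
      le_trans ?_ (mul_le_mul_of_nonneg_right (le_max_right _ _) hG0)⟩
    · rw [← mul_div_assoc]
      exact div_le_div_of_nonneg_right (hreg _ ht).1 (by positivity)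
    · rw [← mul_div_assoc]
      exact div_le_div_of_nonneg_right (hreg _ ht).2 (by positivity)
  · obtain ⟨hω, hlim⟩ := hω
    obtain ⟨l, hl, hl'⟩ := (mem_nhdsLT_iff_exists_Ico_subset).1
      (hlim.eventually_ge_atTop (2 / γ))
    refine hω.exists_kernel_bounds (β := γ / 2) (r₀ := max l 0) (by positivity) (by linarith)
      ⟨le_max_right _ _, max_lt hl zero_lt_one⟩ fun r hr => ?_
    have hr0 : 0 ≤ r := (le_max_right _ _).trans hr.1
    have h1 : 2 / γ ≤ wInt ω r / (ω r * (1 - r)) := hl' ⟨(le_max_left _ _).trans hr.1, hr.2⟩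
    have hpos : 0 < ω r * (1 - r) :=
      mul_pos (hω.1.1 r ⟨hr0, hr.2⟩) (by linarith [hr.2])
    rw [div_le_div_iff₀ hγ hpos] at h1
    linarith
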